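/- Convergence of the Strang splitting with spatial and rational temporal discretization: Let X, X_m, P_m, J_m form an approximation scheme, let A, A_m and B, B_m each be stable and consistent approximating families of operators, and suppose A and B generate strongly continuous semigroups on X and that the closure of A + B (with domain containing D(A) ∩ D(B)) generates a strongly continuous semigroup (U(t))_{t≥0} on X. Let r and q be rational functions with r(0) = r'(0) = 1, q(0) = q'(0) = 1, bounded on ℂ₋, with r(hA_m), q(hB_m) defined via partial fraction decompositions. Suppose there exist M ≥ 1 and ω ∈ ℝ such that ‖[ r((h/2) A_m) q(h B_m) r((h/2) A_m) ]^{k}‖ ≤ M e^{khω} for all h > 0 and all k, m ∈ ℕ. Then for every x ∈ X, lim_{m,n→∞} J_m [ r((t/2n) A_m) q((t/n) B_m) r((t/2n) A_m) ]^{n} P_m x = U(t)x, uniformly for t in compact intervals of [0,∞). -/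

import Mathlib

open Filter Topology

/-- `R` is the resolvent operator `R(lam, A) = (lam - A)⁻¹` of the (possibly
unbounded) linear operator `A`, given as a partially defined linear map. -/
structure IsResolvent {Y : Type*} [NormedAddCommGroup Y] [NormedSpace ℂ Y]
    (A : Y →ₗ.[ℂ] Y) (lam : ℂ) (R : Y →L[ℂ] Y) : Prop where
  mem : ∀ x : Y, R x ∈ A.domain
  eq_right : ∀ x : Y, lam • R x - A ⟨R x, mem x⟩ = x
  eq_left : ∀ y : A.domain, R (lam • (y : Y) - A y) = (y : Y)

/-- The operator `r(h A)` where the rational function `r` is given through its partial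
fraction decomposition `r(z) = Σ_{i,j} C i j • (1 - z/lam i)⁻ʲ` and the operator `A`
through its resolvent family `R`:  `r(h A) = Σ_{i,j} C i j • [(lam i/h) R(lam i/h, A)]ʲ`.
(For `h ≤ 0` it is defined to be the identity, corresponding to `r(0·A) = I`.) -/
noncomputable def ratOp {Y : Type*} [NormedAddCommGroup Y] [NormedSpace ℂ Y]
    (l : ℕ) (ν : Fin l → ℕ) (lam : Fin l → ℂ) (C : Fin l → ℕ → ℂ)
    (R : ℂ → Y →L[ℂ] Y) (h : ℝ) : Y →L[ℂ] Y :=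
  if h ≤ 0 then 1 else
    ∑ i, ∑ j ∈ Finset.Icc 1 (ν i), C i j • ((lam i / (h : ℂ)) • R (lam i / (h : ℂ))) ^ j

/-- The rational function `r(z) = Σ_{i,j} C i j (1 - z/lam i)⁻ʲ` given by a partial
fraction decomposition. -/
noncomputable def pfdFun (l : ℕ) (ν : Fin l → ℕ) (lam : Fin l → ℂ) (C : Fin l → ℕ → ℂ)
    (z : ℂ) : ℂ :=
  ∑ i, ∑ j ∈ Finset.Icc 1 (ν i), C i j * (1 - z / lam i) ^ (-(j : ℤ))

/-- `(T t)_{t ≥ 0}` is a strongly continuous semigroup of bounded linear operators. -/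
def IsC0Semigroup {Y : Type*} [NormedAddCommGroup Y] [NormedSpace ℂ Y]
    (T : ℝ → Y →L[ℂ] Y) : Prop :=
  T 0 = 1 ∧ (∀ s t : ℝ, 0 ≤ s → 0 ≤ t → T (s + t) = T s * T t) ∧
    ∀ x : Y, ContinuousOn (fun t : ℝ => T t x) (Set.Ici 0)

/-- The graph of the generator of a semigroup `T`: pairs `(x, y)` such that
`(T h x - x)/h → y` as `h → 0+`. -/
def generatorGraph {Y : Type*} [NormedAddCommGroup Y] [NormedSpace ℂ Y]
    (T : ℝ → Y →L[ℂ] Y) : Set (Y × Y) :=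
  {p | Tendsto (fun h : ℝ => ((h : ℂ))⁻¹ • (T h p.1 - p.1)) (𝓝[>] (0 : ℝ)) (𝓝 p.2)}

/-- The operator `A` generates the strongly continuous semigroup `T`. -/
def IsGenerator {Y : Type*} [NormedAddCommGroup Y] [NormedSpace ℂ Y]
    (A : Y →ₗ.[ℂ] Y) (T : ℝ → Y →L[ℂ] Y) : Prop :=
  IsC0Semigroup T ∧ (A.graph : Set (Y × Y)) = generatorGraph T

/-- The joint limit: the space index tends to infinity and the time step to `0` from above. -/
def spaceTime : Filter (ℕ × ℝ) := atTop ×ˢ 𝓝[>] (0 : ℝ)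

lemma spaceTime_eventually_pos : ∀ᶠ p in spaceTime, 0 < p.2 :=
  tendsto_snd.eventually (self_mem_nhdsWithin : Set.Ioi (0 : ℝ) ∈ 𝓝[>] (0 : ℝ))

lemma tendsto_snd_spaceTime : Tendsto (fun p : ℕ × ℝ => p.2) spaceTime (𝓝 0) :=
  (tendsto_snd : Tendsto Prod.snd spaceTime (𝓝[>] (0 : ℝ))).mono_right nhdsWithin_le_nhds

lemma tendsto_half_spaceTime :
    Tendsto (fun p : ℕ × ℝ => (p.1, p.2 / 2)) spaceTime spaceTime := by
  refine Tendsto.prodMk tendsto_fst (tendsto_nhdsWithin_iff.2 ⟨?_, ?_⟩)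
  · simpa using tendsto_snd_spaceTime.div_const 2
  · filter_upwards [spaceTime_eventually_pos] with p hp
    exact half_pos hp

section ApproximateIdentity

variable {X : Type*} [NormedAddCommGroup X] [NormedSpace ℂ X]
  {Xm : ℕ → Type*} [∀ m, NormedAddCommGroup (Xm m)] [∀ m, NormedSpace ℂ (Xm m)]

/-- The vectors `y m h` of `Xm m` approximate `x`, along the projections `P m`. -/
def ApproximatesVec (P : ∀ m, X →L[ℂ] Xm m) (y : ∀ m, ℝ → Xm m) (x : X) : Prop :=
  Tendsto (fun p : ℕ × ℝ => ‖y p.1 p.2 - P p.1 x‖) spaceTime (𝓝 0)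

/-- A uniformly bounded family of operators `T m h` on `Xm m` which converges strongly to the
identity, along the projections `P m`, as `m → ∞` and `h → 0+`. -/
structure IsApproxId (P : ∀ m, X →L[ℂ] Xm m) (T : ∀ m, ℝ → Xm m →L[ℂ] Xm m) : Prop where
  bounded : ∃ C, 0 ≤ C ∧ ∀ m h, 0 < h → ‖T m h‖ ≤ C
  tendsto : ∀ x, ApproximatesVec P (fun m h => T m h (P m x)) x

variable {P : ∀ m, X →L[ℂ] Xm m} {S T : ∀ m, ℝ → Xm m →L[ℂ] Xm m}

lemma ApproximatesVec.of_bound {y : ∀ m, ℝ → Xm m} {x : X} {f : ℕ × ℝ → ℝ}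
    (hf : Tendsto f spaceTime (𝓝 0))
    (h : ∀ m h, 0 < h → ‖y m h - P m x‖ ≤ f (m, h)) : ApproximatesVec P y x :=
  squeeze_zero' (Eventually.of_forall fun _ => norm_nonneg _)
    (spaceTime_eventually_pos.mono fun p hp => h p.1 p.2 hp) hf

lemma ApproximatesVec.congr {y z : ∀ m, ℝ → Xm m} {x : X} (hy : ApproximatesVec P y x)
    (h : ∀ m h, 0 < h → z m h = y m h) : ApproximatesVec P z x :=
  .of_bound hy fun m t ht => by rw [h m t ht]

lemma ApproximatesVec.const (x : X) : ApproximatesVec P (fun m _ => P m x) x := by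
  simpa [ApproximatesVec] using tendsto_const_nhds

lemma ApproximatesVec.add {y z : ∀ m, ℝ → Xm m} {x x' : X} (hy : ApproximatesVec P y x)
    (hz : ApproximatesVec P z x') : ApproximatesVec P (fun m h => y m h + z m h) (x + x') := by
  refine .of_bound (f := fun p => ‖y p.1 p.2 - P p.1 x‖ + ‖z p.1 p.2 - P p.1 x'‖)
    (by simpa using Tendsto.add hy hz) fun m h _ => ?_
  rw [map_add, add_sub_add_comm]
  exact norm_add_le _ _

lemma ApproximatesVec.smul {y : ∀ m, ℝ → Xm m} {x : X} (c : ℂ) (hy : ApproximatesVec P y x) :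
    ApproximatesVec P (fun m h => c • y m h) (c • x) := by
  refine .of_bound (f := fun p => ‖c‖ * ‖y p.1 p.2 - P p.1 x‖)
    (by simpa using Tendsto.const_mul ‖c‖ hy) fun m h _ => ?_
  rw [map_smul, ← smul_sub, norm_smul]

lemma ApproximatesVec.sum {ι : Type*} (s : Finset ι) {y : ι → ∀ m, ℝ → Xm m} {x : ι → X}
    (hy : ∀ i ∈ s, ApproximatesVec P (y i) (x i)) :
    ApproximatesVec P (fun m h => ∑ i ∈ s, y i m h) (∑ i ∈ s, x i) := by
  classical
  induction s using Finset.induction_on with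
  | empty => simpa using ApproximatesVec.const (P := P) (0 : X)
  | insert i s hi ih =>
    simp only [Finset.sum_insert hi]
    exact (hy i (Finset.mem_insert_self i s)).add
      (ih fun j hj => hy j (Finset.mem_insert_of_mem hj))

lemma ApproximatesVec.half {y : ∀ m, ℝ → Xm m} {x : X} (hy : ApproximatesVec P y x) :
    ApproximatesVec P (fun m h => y m (h / 2)) x :=
  Tendsto.comp (f := fun p : ℕ × ℝ => (p.1, p.2 / 2)) hy tendsto_half_spaceTime

lemma IsApproxId.apply (hT : IsApproxId P T) {y : ∀ m, ℝ → Xm m} {x : X}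
    (hy : ApproximatesVec P y x) : ApproximatesVec P (fun m h => T m h (y m h)) x := by
  obtain ⟨C, hC, hTC⟩ := hT.bounded
  refine .of_bound (f := fun p => C * ‖y p.1 p.2 - P p.1 x‖ + ‖T p.1 p.2 (P p.1 x) - P p.1 x‖)
    (by simpa using (Tendsto.const_mul C hy).add (hT.tendsto x)) fun m h hh => ?_
  have h1 : T m h (y m h) - P m x
      = T m h (y m h - P m x) + (T m h (P m x) - P m x) := by rw [map_sub]; abel
  rw [h1]
  exact (norm_add_le _ _).trans (by gcongr; exact (T m h).le_of_opNorm_le (hTC m h hh) _)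

lemma IsApproxId.mul (hS : IsApproxId P S) (hT : IsApproxId P T) :
    IsApproxId P (fun m h => S m h * T m h) := by
  refine ⟨?_, fun x => hS.apply (hT.tendsto x)⟩
  obtain ⟨C, hC, hSC⟩ := hS.bounded
  obtain ⟨C', hC', hTC⟩ := hT.bounded
  exact ⟨C * C', by positivity, fun m h hh => (norm_mul_le _ _).trans
    (mul_le_mul (hSC m h hh) (hTC m h hh) (norm_nonneg _) hC)⟩

lemma IsApproxId.one : IsApproxId P (fun m _ => (1 : Xm m →L[ℂ] Xm m)) :=
  ⟨⟨1, zero_le_one, fun _ _ _ => ContinuousLinearMap.norm_id_le⟩, .const⟩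

lemma IsApproxId.pow (hT : IsApproxId P T) (k : ℕ) : IsApproxId P (fun m h => T m h ^ k) := by
  induction k with
  | zero => simpa using IsApproxId.one
  | succ k ih => simpa only [pow_succ] using ih.mul hT

lemma IsApproxId.half (hT : IsApproxId P T) : IsApproxId P (fun m h => T m (h / 2)) := by
  obtain ⟨C, hC, hTC⟩ := hT.bounded
  exact ⟨⟨C, hC, fun m h hh => hTC m _ (half_pos hh)⟩,
    fun x => (hT.tendsto x).half⟩

lemma IsApproxId.of_dense {K C : ℝ} (hC : 0 ≤ C) (hP : ∀ m, ‖P m‖ ≤ K)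
    (hTC : ∀ m h, 0 < h → ‖T m h‖ ≤ C) {s : Set X} (hs : Dense s)
    (h : ∀ x ∈ s, ApproximatesVec P (fun m h => T m h (P m x)) x) : IsApproxId P T := by
  have hK : 0 ≤ K := (norm_nonneg _).trans (hP 0)
  refine ⟨⟨C, hC, hTC⟩, fun x => ?_⟩
  rw [ApproximatesVec, Metric.tendsto_nhds]
  intro ε hε
  obtain ⟨y, hys, hxy⟩ := Metric.dense_iff.1 hs x (ε / (2 * ((C + 1) * K + 1))) (by positivity)
  have hy := (Metric.tendsto_nhds.1 (h y hxy)) (ε / 2) (by positivity)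
  filter_upwards [hy, spaceTime_eventually_pos] with p hp hpos
  rw [Real.dist_0_eq_abs, abs_norm] at hp ⊢
  have hd : ‖x - y‖ ≤ ε / (2 * ((C + 1) * K + 1)) := by
    rw [← dist_eq_norm, dist_comm]; exact (Metric.mem_ball.1 hys).le
  have hPd : ‖P p.1 (x - y)‖ ≤ K * ‖x - y‖ := (P p.1).le_of_opNorm_le (hP _) _
  have hTd : ‖T p.1 p.2 (P p.1 (x - y))‖ ≤ C * (K * ‖x - y‖) :=
    ((T p.1 p.2).le_of_opNorm_le (hTC _ _ hpos) _).trans (by gcongr)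
  have hsplit : T p.1 p.2 (P p.1 x) - P p.1 x
      = T p.1 p.2 (P p.1 (x - y)) - P p.1 (x - y) + (T p.1 p.2 (P p.1 y) - P p.1 y) := by
    simp only [map_sub]; abel
  have hfinal : ((C + 1) * K) * ‖x - y‖ ≤ ε / 2 := by
    calc ((C + 1) * K) * ‖x - y‖ ≤ ((C + 1) * K + 1) * (ε / (2 * ((C + 1) * K + 1))) := by
          gcongr; linarith
      _ = ε / 2 := by field_simp
  rw [hsplit]
  have h1 := norm_add_le (T p.1 p.2 (P p.1 (x - y)) - P p.1 (x - y))
    (T p.1 p.2 (P p.1 y) - P p.1 y)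
  have h2 := norm_sub_le (T p.1 p.2 (P p.1 (x - y))) (P p.1 (x - y))
  linarith

end ApproximateIdentity

section Resolvent

variable {X : Type*} [NormedAddCommGroup X] [NormedSpace ℂ X]
  {Xm : ℕ → Type*} [∀ m, NormedAddCommGroup (Xm m)] [∀ m, NormedSpace ℂ (Xm m)]
  {P : ∀ m, X →L[ℂ] Xm m}

lemma pow_sub_one_apply {Y : Type*} [NormedAddCommGroup Y] [NormedSpace ℂ Y] (N : Y →L[ℂ] Y)
    {c : ℂ} {y z : Y} (h : N y - y = c • N z) (j : ℕ) :
    (N ^ j) y - y = c • ∑ k ∈ Finset.range j, (N ^ (k + 1)) z := by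
  induction j with
  | zero => simp
  | succ j ih =>
    rw [Finset.sum_range_succ, smul_add, ← ih, pow_succ]
    simp only [mul_apply_eq_comp]
    rw [← map_smul, ← h, map_sub]
    abel

lemma IsResolvent.smul_apply_sub {Y : Type*} [NormedAddCommGroup Y] [NormedSpace ℂ Y]
    {A : Y →ₗ.[ℂ] Y} {μ : ℂ} {R : Y →L[ℂ] Y} (hR : IsResolvent A μ R) (y : A.domain) :
    (μ • R) (y : Y) - y = R (A y) := by
  have h := hR.eq_left y
  rw [map_sub, map_smul] at h
  rw [smul_apply, sub_eq_iff_eq_add, ← sub_eq_iff_eq_add', h]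

lemma re_div_ofReal_pos {lam : ℂ} (hlam : 0 < lam.re) {h : ℝ} (hh : 0 < h) :
    0 < (lam / (h : ℂ)).re := by
  rw [Complex.div_ofReal_re]; positivity

lemma norm_smul_resolvent_le {Y : Type*} [NormedAddCommGroup Y] [NormedSpace ℂ Y]
    {R : ℂ → Y →L[ℂ] Y} {M : ℝ} (hR : ∀ μ : ℂ, 0 < μ.re → μ.re * ‖R μ‖ ≤ M)
    {lam : ℂ} (hlam : 0 < lam.re) {h : ℝ} (hh : 0 < h) :
    ‖(lam / (h : ℂ)) • R (lam / (h : ℂ))‖ ≤ ‖lam‖ / lam.re * M := by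
  have h1 := hR _ (re_div_ofReal_pos hlam hh)
  rw [Complex.div_ofReal_re] at h1
  rw [norm_smul, norm_div, Complex.norm_real, Real.norm_of_nonneg hh.le]
  calc ‖lam‖ / h * ‖R (lam / h)‖ = ‖lam‖ / lam.re * (lam.re / h * ‖R (lam / h)‖) := by
        field_simp
    _ ≤ _ := by gcongr

variable {A : X →ₗ.[ℂ] X} {Am : ∀ m, Xm m →ₗ.[ℂ] Xm m} {R : ∀ m, ℂ → Xm m →L[ℂ] Xm m}

lemma approximatesVec_of_consistent {J : ∀ m, Xm m →L[ℂ] X}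
    (hPJ : ∀ m (y : Xm m), P m (J m y) = y)
    (hJP : ∀ x : X, Tendsto (fun m => J m (P m x)) atTop (𝓝 x))
    {K : ℝ} (hP : ∀ m, ‖P m‖ ≤ K) {y : ∀ m, Xm m} {x : X}
    (h : Tendsto (fun m => J m (y m)) atTop (𝓝 x)) : ApproximatesVec P (fun m _ => y m) x := by
  have h0 : Tendsto (fun m => K * ‖J m (y m) - J m (P m x)‖) atTop (𝓝 0) := by
    simpa using ((h.sub (hJP x)).norm).const_mul K
  refine .of_bound (h0.comp (tendsto_fst : Tendsto Prod.fst spaceTime atTop)) fun m _ _ => ?_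
  calc ‖y m - P m x‖ = ‖P m (J m (y m) - J m (P m x))‖ := by rw [map_sub, hPJ, hPJ]
    _ ≤ _ := (P m).le_of_opNorm_le (hP m) _

lemma smul_resolvent_apply_sub (hR : ∀ m, ∀ μ : ℂ, 0 < μ.re → IsResolvent (Am m) μ (R m μ))
    {lam : ℂ} (hlam : 0 < lam.re) {h : ℝ} (hh : 0 < h) (m : ℕ) (y : (Am m).domain) :
    ((lam / (h : ℂ)) • R m (lam / (h : ℂ))) (y : Xm m) - y
      = ((h : ℂ) / lam) • ((lam / (h : ℂ)) • R m (lam / (h : ℂ))) (Am m y) := by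
  have h1 : lam ≠ 0 := fun h0 => by simp [h0] at hlam
  have h2 : (h : ℂ) ≠ 0 := by exact_mod_cast hh.ne'
  rw [(hR m _ (re_div_ofReal_pos hlam hh)).smul_apply_sub, smul_apply,
    smul_smul, div_mul_div_cancel₀ h1, div_self h2, one_smul]

lemma isApproxId_smul_resolvent {K M : ℝ} (hP : ∀ m, ‖P m‖ ≤ K) (hM : 0 ≤ M)
    (hdense : Dense (A.domain : Set X))
    (hR : ∀ m, ∀ μ : ℂ, 0 < μ.re → IsResolvent (Am m) μ (R m μ) ∧ μ.re * ‖R m μ‖ ≤ M)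
    (hdom : ∀ m, ∀ x ∈ A.domain, P m x ∈ (Am m).domain)
    (hcons : ∀ x : A.domain,
      ApproximatesVec P (fun m _ => Am m ⟨P m (x : X), hdom m x x.2⟩) (A x))
    {lam : ℂ} (hlam : 0 < lam.re) :
    IsApproxId P (fun m h => (lam / (h : ℂ)) • R m (lam / (h : ℂ))) := by
  have hK : 0 ≤ K := (norm_nonneg _).trans (hP 0)
  have hN : ∀ m h, 0 < h → ‖(lam / ((h : ℝ) : ℂ)) • R m (lam / (h : ℂ))‖ ≤ ‖lam‖ / lam.re * M :=
    fun m h hh => norm_smul_resolvent_le (fun μ hμ => (hR m μ hμ).2) hlam hh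
  refine IsApproxId.of_dense (by positivity) hP hN hdense fun x hx => ?_
  refine .of_bound (f := fun p => p.2 / ‖lam‖ * (‖lam‖ / lam.re * M *
    (‖Am p.1 ⟨P p.1 x, hdom p.1 x hx⟩ - P p.1 (A ⟨x, hx⟩)‖ + K * ‖A ⟨x, hx⟩‖))) ?_ ?_
  · simpa using (tendsto_snd_spaceTime.div_const ‖lam‖).mul
      ((Tendsto.add_const (K * ‖A ⟨x, hx⟩‖) (hcons ⟨x, hx⟩)).const_mul (‖lam‖ / lam.re * M))
  · intro m h hh
    rw [smul_resolvent_apply_sub (fun m μ hμ => (hR m μ hμ).1) hlam hh m ⟨P m x, hdom m x hx⟩,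
      norm_smul, norm_div, Complex.norm_real, Real.norm_of_nonneg hh.le]
    gcongr
    refine (ContinuousLinearMap.le_of_opNorm_le _ (hN m h hh) _).trans ?_
    gcongr
    calc ‖Am m ⟨P m x, hdom m x hx⟩‖
        = ‖(Am m ⟨P m x, hdom m x hx⟩ - P m (A ⟨x, hx⟩)) + P m (A ⟨x, hx⟩)‖ := by
          rw [sub_add_cancel]
      _ ≤ _ := (norm_add_le _ _).trans (by gcongr; exact (P m).le_of_opNorm_le (hP m) _)

end Resolvent

section RationalFunction

lemma pfdFun_zero (l : ℕ) (ν : Fin l → ℕ) (lam : Fin l → ℂ) (C : Fin l → ℕ → ℂ) :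
    pfdFun l ν lam C 0 = ∑ i, ∑ j ∈ Finset.Icc 1 (ν i), C i j := by
  simp [pfdFun]

lemma hasDerivAt_pfdFun_zero (l : ℕ) (ν : Fin l → ℕ) (lam : Fin l → ℂ) (C : Fin l → ℕ → ℂ) :
    HasDerivAt (pfdFun l ν lam C) (∑ i, ∑ j ∈ Finset.Icc 1 (ν i), C i j * (j / lam i)) 0 := by
  unfold pfdFun
  refine HasDerivAt.fun_sum fun i _ => HasDerivAt.fun_sum fun j _ => HasDerivAt.const_mul _ ?_
  have h1 : HasDerivAt (fun z : ℂ => 1 - z / lam i) (-(1 / lam i)) 0 :=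
    ((hasDerivAt_id (0 : ℂ)).div_const (lam i)).const_sub 1
  have h2 := hasDerivAt_zpow (-(j : ℤ)) (1 - (0 : ℂ) / lam i) (Or.inl (by simp))
  refine (h2.comp (0 : ℂ) h1).congr_deriv ?_
  simp [div_eq_mul_inv]

variable {X : Type*} [NormedAddCommGroup X] [NormedSpace ℂ X]
  {Xm : ℕ → Type*} [∀ m, NormedAddCommGroup (Xm m)] [∀ m, NormedSpace ℂ (Xm m)]
  {P : ∀ m, X →L[ℂ] Xm m}
  {A : X →ₗ.[ℂ] X} {Am : ∀ m, Xm m →ₗ.[ℂ] Xm m} {R : ∀ m, ℂ → Xm m →L[ℂ] Xm m}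
  {l : ℕ} {ν : Fin l → ℕ} {lam : Fin l → ℂ} {C : Fin l → ℕ → ℂ}

lemma isApproxId_ratOp
    (hN : ∀ i, IsApproxId P (fun m h => (lam i / (h : ℂ)) • R m (lam i / (h : ℂ))))
    (h0 : pfdFun l ν lam C 0 = 1) :
    IsApproxId P (fun m h => ratOp l ν lam C (R m) h) := by
  refine ⟨?_, fun x => ?_⟩
  · choose D hD hND using fun i => (hN i).bounded
    refine ⟨∑ i, ∑ j ∈ Finset.Icc 1 (ν i), ‖C i j‖ * D i ^ j, Finset.sum_nonneg fun i _ =>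
      Finset.sum_nonneg fun j _ => mul_nonneg (norm_nonneg _) (pow_nonneg (hD i) j),
      fun m h hh => ?_⟩
    rw [ratOp, if_neg (not_le.2 hh)]
    refine norm_sum_le_of_le _ fun i _ => norm_sum_le_of_le _ fun j hj => ?_
    rw [norm_smul]
    gcongr
    exact (norm_pow_le' _ (Finset.mem_Icc.1 hj).1).trans
      (pow_le_pow_left₀ (norm_nonneg _) (hND i m h hh) j)
  · have h1 : ApproximatesVec P (fun m h => ∑ i, ∑ j ∈ Finset.Icc 1 (ν i),
        C i j • (((lam i / (h : ℂ)) • R m (lam i / (h : ℂ))) ^ j) (P m x))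
        (∑ i, ∑ j ∈ Finset.Icc 1 (ν i), C i j • x) :=
      .sum _ fun i _ => .sum _ fun j _ => .smul _ (((hN i).pow j).tendsto x)
    simp only [← Finset.sum_smul] at h1
    rw [← pfdFun_zero l ν lam C, h0, one_smul] at h1
    refine h1.congr fun m h hh => ?_
    rw [ratOp, if_neg (not_le.2 hh)]
    simp

lemma ratOp_consistent
    (hN : ∀ i, IsApproxId P (fun m h => (lam i / (h : ℂ)) • R m (lam i / (h : ℂ))))
    (h0 : pfdFun l ν lam C 0 = 1) (h1 : HasDerivAt (pfdFun l ν lam C) 1 0)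
    (hlam : ∀ i, 0 < (lam i).re)
    (hR : ∀ m, ∀ μ : ℂ, 0 < μ.re → IsResolvent (Am m) μ (R m μ))
    (hdom : ∀ m, ∀ x ∈ A.domain, P m x ∈ (Am m).domain)
    (hcons : ∀ x : A.domain,
      ApproximatesVec P (fun m _ => Am m ⟨P m (x : X), hdom m x x.2⟩) (A x)) (x : A.domain) :
    ApproximatesVec P (fun m h => ((h : ℂ))⁻¹ • (ratOp l ν lam C (R m) h (P m x) - P m x))
      (A x) := by
  have key : ApproximatesVec P (fun m h => ∑ i, ∑ j ∈ Finset.Icc 1 (ν i),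
      (C i j * (lam i)⁻¹) • ∑ k ∈ Finset.range j,
        (((lam i / (h : ℂ)) • R m (lam i / (h : ℂ))) ^ (k + 1))
          (Am m ⟨P m (x : X), hdom m x x.2⟩))
      (∑ i, ∑ j ∈ Finset.Icc 1 (ν i), (C i j * (lam i)⁻¹) • ∑ _k ∈ Finset.range j, A x) :=
    .sum _ fun i _ => .sum _ fun j _ => .smul _ (.sum _ fun k _ =>
      ((hN i).pow (k + 1)).apply (hcons x))
  have hlim : (∑ i, ∑ j ∈ Finset.Icc 1 (ν i), (C i j * (lam i)⁻¹) • ∑ _k ∈ Finset.range j, A x)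
      = A x := by
    have h2 := (hasDerivAt_pfdFun_zero l ν lam C).unique h1
    conv_rhs => rw [← one_smul ℂ (A x), ← h2]
    simp only [Finset.sum_smul, Finset.sum_const, Finset.card_range, ← Nat.cast_smul_eq_nsmul ℂ,
      smul_smul]
    refine Finset.sum_congr rfl fun i _ => Finset.sum_congr rfl fun j _ => ?_
    congr 1
    ring
  rw [hlim] at key
  refine key.congr fun m h hh => ?_
  have hh' : (h : ℂ) ≠ 0 := by exact_mod_cast hh.ne'
  have hone : P m (x : X) = ∑ i, ∑ j ∈ Finset.Icc 1 (ν i), C i j • P m (x : X) := by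
    simp only [← Finset.sum_smul]
    rw [← pfdFun_zero l ν lam C, h0, one_smul]
  have hrat : ratOp l ν lam C (R m) h (P m x) = ∑ i, ∑ j ∈ Finset.Icc 1 (ν i),
      C i j • (((lam i / (h : ℂ)) • R m (lam i / (h : ℂ))) ^ j) (P m (x : X)) := by
    rw [ratOp, if_neg (not_le.2 hh)]
    simp
  conv_lhs => rw [hrat]; enter [2, 2]; rw [hone]
  simp only [← Finset.sum_sub_distrib, Finset.smul_sum (r := ((h : ℂ))⁻¹)]
  refine Finset.sum_congr rfl fun i _ => Finset.sum_congr rfl fun j _ => ?_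
  rw [← smul_sub, pow_sub_one_apply _ (smul_resolvent_apply_sub hR (hlam i) hh m
    ⟨P m x, hdom m x x.2⟩) j, smul_smul, smul_smul]
  congr 1
  field_simp

end RationalFunction

section Strang

variable {X : Type*} [NormedAddCommGroup X] [NormedSpace ℂ X]
  {Xm : ℕ → Type*} [∀ m, NormedAddCommGroup (Xm m)] [∀ m, NormedSpace ℂ (Xm m)]
  {P : ∀ m, X →L[ℂ] Xm m} {S T : ∀ m, ℝ → Xm m →L[ℂ] Xm m}

lemma strang_consistent (hS : IsApproxId P S) (hT : IsApproxId P T) {x a b : X}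
    (ha : ApproximatesVec P (fun m h => ((h : ℂ))⁻¹ • (S m h (P m x) - P m x)) a)
    (hb : ApproximatesVec P (fun m h => ((h : ℂ))⁻¹ • (T m h (P m x) - P m x)) b) :
    ApproximatesVec P (fun m h => ((h : ℂ))⁻¹ •
      ((S m (h / 2) * T m h * S m (h / 2)) (P m x) - P m x)) (a + b) := by
  have ha' : ApproximatesVec P
      (fun m h => (((h / 2 : ℝ) : ℂ))⁻¹ • (S m (h / 2) (P m x) - P m x)) a := ha.half
  have h1 := ((hS.half.mul hT).apply (ha'.smul (1 / 2))).add
    ((hS.half.apply hb).add (ha'.smul (1 / 2)))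
  have hab : (1 / 2 : ℂ) • a + (b + (1 / 2 : ℂ) • a) = a + b := by module
  rw [hab] at h1
  refine h1.congr fun m h hh => ?_
  have hc : (1 / 2 : ℂ) * (((h / 2 : ℝ) : ℂ))⁻¹ = ((h : ℂ))⁻¹ := by
    have hh' : (h : ℂ) ≠ 0 := by exact_mod_cast hh.ne'
    push_cast
    field_simp
  simp only [smul_smul, hc, map_smul, map_sub, ← smul_add, mul_apply_eq_comp]
  congr 1
  abel

end Strang

section PiecewiseLinear

variable {E : Type*} [NormedAddCommGroup E] [NormedSpace ℝ E]

/-- The piecewise linear interpolation of the sequence `W`, with nodes `0, s, 2s, …`. -/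
noncomputable def interpolate (s : ℝ) (W : ℕ → E) (t : ℝ) : E :=
  (1 - (t / s - ⌊t / s⌋₊)) • W ⌊t / s⌋₊ + (t / s - ⌊t / s⌋₊) • W (⌊t / s⌋₊ + 1)

lemma floor_mul_le {s t : ℝ} (hs : 0 < s) (ht : 0 ≤ t) : ⌊t / s⌋₊ * s ≤ t :=
  (le_div_iff₀ hs).1 (Nat.floor_le (by positivity))

lemma lt_floor_add_one_mul {s t : ℝ} (hs : 0 < s) : t < (⌊t / s⌋₊ + 1) * s :=
  (div_lt_iff₀ hs).1 (Nat.lt_floor_add_one _)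

lemma norm_one_sub_smul_add_smul_le {x y : E} {θ c : ℝ} (h0 : 0 ≤ θ) (h1 : θ ≤ 1)
    (hx : ‖x‖ ≤ c) (hy : ‖y‖ ≤ c) : ‖(1 - θ) • x + θ • y‖ ≤ c := by
  have h := (convex_closedBall (0 : E) c) (mem_closedBall_zero_iff.2 hx)
    (mem_closedBall_zero_iff.2 hy) (sub_nonneg.2 h1) h0 (by ring)
  exact mem_closedBall_zero_iff.1 h

lemma norm_interpolate_le {s t c : ℝ} (hs : 0 < s) (ht : 0 ≤ t) {W : ℕ → E}
    (h0 : ‖W ⌊t / s⌋₊‖ ≤ c) (h1 : ‖W (⌊t / s⌋₊ + 1)‖ ≤ c) : ‖interpolate s W t‖ ≤ c :=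
  norm_one_sub_smul_add_smul_le (sub_nonneg.2 (Nat.floor_le (by positivity)))
    (by linarith [Nat.lt_floor_add_one (t / s)]) h0 h1

lemma interpolate_sub_const (s : ℝ) (W : ℕ → E) (t : ℝ) (y : E) :
    interpolate s W t - y = interpolate s (fun j => W j - y) t := by
  unfold interpolate
  module

lemma norm_interpolate_sub_le {s t c : ℝ} (hs : 0 < s) (ht : 0 ≤ t) {W : ℕ → E} {y : E}
    (h0 : ‖W ⌊t / s⌋₊ - y‖ ≤ c) (h1 : ‖W (⌊t / s⌋₊ + 1) - y‖ ≤ c) :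
    ‖interpolate s W t - y‖ ≤ c := by
  rw [interpolate_sub_const]
  exact norm_interpolate_le hs ht h0 h1

lemma interpolate_sub_interpolate {s a b : ℝ} (hs : 0 < s) (ha : 0 ≤ a) (hab : a ≤ b)
    (hb : b ≤ a + s) (W : ℕ → E) : ∃ α β : ℝ, 0 ≤ α ∧ 0 ≤ β ∧ (α + β) * s = b - a ∧
      interpolate s W b - interpolate s W a = α • (W (⌊a / s⌋₊ + 1) - W ⌊a / s⌋₊)
        + β • (W (⌊a / s⌋₊ + 2) - W (⌊a / s⌋₊ + 1)) := by
  have h1 : ⌊a / s⌋₊ ≤ ⌊b / s⌋₊ := Nat.floor_mono (by gcongr)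
  have h2 : ⌊b / s⌋₊ ≤ ⌊a / s⌋₊ + 1 := by
    rw [← Nat.floor_add_one (by positivity)]
    refine Nat.floor_mono ?_
    rw [div_add_one hs.ne']
    gcongr
  obtain h | h : ⌊b / s⌋₊ = ⌊a / s⌋₊ ∨ ⌊b / s⌋₊ = ⌊a / s⌋₊ + 1 := by omega
  · refine ⟨b / s - a / s, 0, sub_nonneg.2 (by gcongr), le_rfl, by field_simp; ring, ?_⟩
    unfold interpolate
    rw [h]
    module
  · refine ⟨1 - (a / s - ⌊a / s⌋₊), b / s - ⌊b / s⌋₊,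
      by linarith [Nat.lt_floor_add_one (a / s)],
      sub_nonneg.2 (Nat.floor_le (by have := ha.trans hab; positivity)), ?_, ?_⟩
    · rw [h]; push_cast; field_simp; ring
    · unfold interpolate
      rw [h]
      push_cast
      module

/-- Approximating a `C¹` curve together with its derivative: the interpolation of sufficiently
good approximations `W j` of the values `(v (j s), v' (j s))`. -/
lemma norm_interpolate_fst_sub_sub_le {v v' : ℝ → E} {s ε : ℝ} (hs : 0 < s)
    (hv : ∀ t, HasDerivAt v (v' t) t) {a b : ℝ} (ha : 0 ≤ a) (hab : a ≤ b) (hb : b ≤ a + s)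
    (hosc : ∀ t, 0 ≤ t → |t - a| ≤ 2 * s → ‖v' t - v' a‖ ≤ ε / 4)
    {w g : ℕ → E} (hw : ∀ j : ℕ, ‖w j - v (j * s)‖ ≤ ε * s / 8)
    (hg : ∀ j : ℕ, ‖g j - v' (j * s)‖ ≤ ε / 4) :
    ‖interpolate s w b - interpolate s w a - (b - a) • interpolate s g a‖ ≤ ε * (b - a) := by
  have hfa := floor_mul_le hs ha
  have hfa' := lt_floor_add_one_mul (t := a) hs
  set j := ⌊a / s⌋₊ with hj
  have hjs : 0 ≤ (j : ℝ) * s := by positivity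
  have hgn : ∀ i : ℕ, j ≤ i → i ≤ j + 1 → ‖g i - v' a‖ ≤ ε / 2 := by
    intro i hi hi'
    have hi1 : (j : ℝ) ≤ i := by exact_mod_cast hi
    have hi2 : (i : ℝ) ≤ j + 1 := by exact_mod_cast hi'
    have : |(i : ℝ) * s - a| ≤ 2 * s := by rw [abs_le]; constructor <;> nlinarith
    have h1 := hosc (i * s) (by positivity) this
    calc ‖g i - v' a‖ = ‖(g i - v' (i * s)) + (v' (i * s) - v' a)‖ := by rw [sub_add_sub_cancel]
      _ ≤ ε / 4 + ε / 4 := (norm_add_le _ _).trans (add_le_add (hg i) h1)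
      _ = ε / 2 := by ring
  have hga : ‖interpolate s g a - v' a‖ ≤ ε / 2 :=
    norm_interpolate_sub_le hs ha (hgn _ le_rfl (by omega)) (hgn _ (by omega) le_rfl)
  have hslope : ∀ i : ℕ, j ≤ i → i ≤ j + 1 →
      ‖w (i + 1) - w i - s • interpolate s g a‖ ≤ ε * s := by
    intro i hi hi'
    have hi1 : (j : ℝ) ≤ i := by exact_mod_cast hi
    have hi2 : (i : ℝ) ≤ j + 1 := by exact_mod_cast hi'
    have hmv := norm_image_sub_le_of_norm_deriv_le_segment' (f := fun t => v t - t • v' a)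
      (f' := fun t => v' t - v' a) (C := ε / 4) (a := i * s) (b := (i + 1) * s)
      (fun t _ => ((hv t).sub ((hasDerivAt_id t).smul_const (v' a))).hasDerivWithinAt.congr_deriv
        (by simp))
      (fun t ht => hosc t ((by positivity : 0 ≤ (i : ℝ) * s).trans ht.1) (by
        obtain ⟨h1, h2⟩ := ht
        rw [abs_le]; constructor <;> nlinarith))
      ((i + 1) * s) ⟨by nlinarith, le_rfl⟩
    have h1 := hw (i + 1)
    have h2 := hw i
    push_cast at h1
    have hsplit : w (i + 1) - w i - s • interpolate s g a
        = (w (i + 1) - v ((i + 1) * s)) - (w i - v (i * s))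
          + ((v ((i + 1) * s) - ((i + 1) * s) • v' a) - (v (i * s) - (i * s) • v' a))
          - s • (interpolate s g a - v' a) := by module
    rw [hsplit]
    have h3 : ‖s • (interpolate s g a - v' a)‖ ≤ s * (ε / 2) := by
      rw [norm_smul, Real.norm_of_nonneg hs.le]; gcongr
    refine (norm_sub_le _ _).trans ((add_le_add ((norm_add_le _ _).trans
      (add_le_add (norm_sub_le _ _) hmv)) h3).trans ?_)
    linarith
  obtain ⟨α, β, hα, hβ, hαβ, heq⟩ := interpolate_sub_interpolate hs ha hab hb w
  have hsplit : interpolate s w b - interpolate s w a - (b - a) • interpolate s g a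
      = α • (w (j + 1) - w j - s • interpolate s g a)
        + β • (w (j + 1 + 1) - w (j + 1) - s • interpolate s g a) := by
    rw [heq, ← hαβ]
    module
  rw [hsplit]
  calc _ ≤ α * (ε * s) + β * (ε * s) := by
        refine (norm_add_le _ _).trans (add_le_add ?_ ?_)
        · rw [norm_smul, Real.norm_of_nonneg hα]
          gcongr
          exact hslope j le_rfl (by omega)
        · rw [norm_smul, Real.norm_of_nonneg hβ]
          gcongr
          exact hslope (j + 1) (by omega) le_rfl
    _ = ε * (b - a) := by rw [← hαβ]; ring

end PiecewiseLinear

section Orbit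

variable {X : Type*} [NormedAddCommGroup X] [NormedSpace ℂ X]

lemma IsC0Semigroup.continuous_orbit {U : ℝ → X →L[ℂ] X} (hU : IsC0Semigroup U) (x : X) :
    Continuous fun t => U (max t 0) x :=
  (hU.2.2 x).comp_continuous (by fun_prop) fun _ => Set.mem_Ici.2 (le_max_right _ _)

lemma IsC0Semigroup.apply_orbit {U : ℝ → X →L[ℂ] X} (hU : IsC0Semigroup U) (x : X) {h t : ℝ}
    (hh : 0 ≤ h) (ht : 0 ≤ t) : U h (U (max t 0) x) = U (max (t + h) 0) x := by
  rw [max_eq_left ht, max_eq_left (by positivity), add_comm t h, hU.2.1 h t hh ht]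
  rfl

variable [CompleteSpace X]

/-- The average of the curve `u` over `[t, t + σ]`. -/
noncomputable def movingAverage (u : ℝ → X) (σ t : ℝ) : X := σ⁻¹ • ∫ τ in t..(t + σ), u τ

lemma hasDerivAt_movingAverage {u : ℝ → X} (hu : Continuous u) (σ t : ℝ) :
    HasDerivAt (movingAverage u σ) (σ⁻¹ • (u (t + σ) - u t)) t := by
  have hF : ∀ b, HasDerivAt (fun t => ∫ τ in (0 : ℝ)..t, u τ) (u b) b := fun b =>
    (hu.integral_hasStrictDerivAt 0 b).hasDerivAt
  have h1 := ((HasDerivAt.comp_add_const t σ (hF (t + σ))).sub (hF t)).const_smul σ⁻¹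
  refine h1.congr_of_eventuallyEq (Eventually.of_forall fun s => ?_)
  simp only [movingAverage, Pi.smul_apply, Pi.sub_apply]
  rw [intervalIntegral.integral_interval_sub_left (hu.intervalIntegrable _ _)
    (hu.intervalIntegrable _ _)]

lemma norm_movingAverage_sub_le {u : ℝ → X} (hu : Continuous u) {σ t ε : ℝ} (hσ : 0 < σ)
    (h : ∀ τ ∈ Set.Icc t (t + σ), ‖u τ - u t‖ ≤ ε) : ‖movingAverage u σ t - u t‖ ≤ ε := by
  have h1 : movingAverage u σ t - u t = σ⁻¹ • ∫ τ in t..(t + σ), (u τ - u t) := by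
    rw [intervalIntegral.integral_sub (hu.intervalIntegrable _ _)
      (continuous_const.intervalIntegrable _ _), intervalIntegral.integral_const,
      add_sub_cancel_left, smul_sub, smul_smul, inv_mul_cancel₀ hσ.ne', one_smul, movingAverage]
  rw [h1, norm_smul, norm_inv, Real.norm_of_nonneg hσ.le, inv_mul_le_iff₀ hσ, mul_comm]
  have h2 := intervalIntegral.norm_integral_le_of_norm_le_const (a := t) (b := t + σ)
    (f := fun τ => u τ - u t) (C := ε) fun τ hτ => h τ (by
      rw [Set.uIoc_of_le (by linarith)] at hτ
      exact ⟨hτ.1.le, hτ.2⟩)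
  simpa [abs_of_pos hσ] using h2

lemma IsC0Semigroup.movingAverage_mem_generatorGraph {U : ℝ → X →L[ℂ] X}
    (hU : IsC0Semigroup U) (x : X) {σ t : ℝ} (hσ : 0 ≤ σ) (ht : 0 ≤ t) :
    (movingAverage (fun t => U (max t 0) x) σ t,
      σ⁻¹ • (U (max (t + σ) 0) x - U (max t 0) x)) ∈ generatorGraph U := by
  have hu := hU.continuous_orbit x
  have hd := (hasDerivAt_movingAverage hu σ t).tendsto_slope_zero_right
  refine hd.congr' ?_
  filter_upwards [self_mem_nhdsWithin] with h hh
  have hh0 : 0 ≤ h := le_of_lt hh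
  have hcomm : U h (movingAverage (fun t => U (max t 0) x) σ t)
      = movingAverage (fun t => U (max t 0) x) σ (t + h) := by
    rw [movingAverage, movingAverage, (U h).map_smul_of_tower,
      ← (U h).intervalIntegral_comp_comm (hu.intervalIntegrable _ _), add_right_comm t h σ,
      ← intervalIntegral.integral_comp_add_right (fun τ => U (max τ 0) x)]
    congr 1
    refine intervalIntegral.integral_congr fun τ hτ => ?_
    rw [Set.uIcc_of_le (by linarith)] at hτ
    exact hU.apply_orbit x hh0 (ht.trans hτ.1)
  simp only [hcomm, ← Complex.ofReal_inv, Complex.coe_smul]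

lemma uniform_osc_of_continuous {E : Type*} [NormedAddCommGroup E] {f : ℝ → E}
    (hf : Continuous f) (T : ℝ) {ε : ℝ} (hε : 0 < ε) :
    ∃ δ > 0, ∀ a b, 0 ≤ a → a ≤ T → 0 ≤ b → b ≤ T → |a - b| ≤ δ → ‖f a - f b‖ ≤ ε := by
  obtain ⟨δ, hδ, h⟩ := Metric.uniformContinuousOn_iff_le.1
    ((isCompact_Icc (a := 0) (b := T)).uniformContinuousOn_of_continuous hf.continuousOn) ε hε
  exact ⟨δ, hδ, fun a b ha ha' hb hb' hab => by
    simpa [dist_eq_norm] using h a ⟨ha, ha'⟩ b ⟨hb, hb'⟩ (by simpa [Real.dist_eq] using hab)⟩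

/-- Orbits of the semigroup `U` are approximated by piecewise linear curves with nodes in a
core `D` of the generator, which almost solve the abstract Cauchy problem. -/
lemma exists_interpolate_near_orbit {U : ℝ → X →L[ℂ] X} (hU : IsC0Semigroup U) {D : Set (X × X)}
    (hD : generatorGraph U ⊆ closure D) (x : X) {T ε : ℝ} (hT : 0 ≤ T) (hε : 0 < ε) :
    ∃ s > 0, ∃ W : ℕ → X × X, (∀ j, W j ∈ D) ∧
      (∀ t, 0 ≤ t → t ≤ T → ‖interpolate s (fun j => (W j).1) t - U t x‖ ≤ ε) ∧
      ∀ a b, 0 ≤ a → a ≤ b → b ≤ T → b ≤ a + s →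
        ‖interpolate s (fun j => (W j).1) b - interpolate s (fun j => (W j).1) a
          - (b - a) • interpolate s (fun j => (W j).2) a‖ ≤ ε * (b - a) := by
  set u : ℝ → X := fun t => U (max t 0) x with hudef
  have hu : Continuous u := hU.continuous_orbit x
  obtain ⟨σ, hσ, hσu⟩ : ∃ σ > 0, ∀ t, 0 ≤ t → t ≤ T → ‖movingAverage u σ t - u t‖ ≤ ε / 4 := by
    obtain ⟨δ, hδ, h⟩ := uniform_osc_of_continuous hu (T + 1) (ε := ε / 4) (by positivity)
    refine ⟨min δ 1, by positivity, fun t ht htT => ?_⟩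
    refine norm_movingAverage_sub_le hu (by positivity) fun τ hτ => ?_
    have h1 := min_le_left δ 1
    have h2 := min_le_right δ 1
    exact h τ t (by linarith [hτ.1]) (by linarith [hτ.2]) ht (by linarith)
      (by rw [abs_le]; constructor <;> linarith [hτ.1, hτ.2])
  set v := movingAverage u σ with hv
  set v' : ℝ → X := fun t => σ⁻¹ • (u (t + σ) - u t) with hv'
  have hvd : ∀ t, HasDerivAt v (v' t) t := hasDerivAt_movingAverage hu σ
  have hvc : Continuous v := continuous_iff_continuousAt.2 fun t => (hvd t).continuousAt
  have hv'c : Continuous v' := by fun_prop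
  obtain ⟨δ₁, hδ₁, hosc₁⟩ := uniform_osc_of_continuous hvc (T + 2) (ε := ε / 4) (by positivity)
  obtain ⟨δ₂, hδ₂, hosc₂⟩ := uniform_osc_of_continuous hv'c (T + 2) (ε := ε / 4) (by positivity)
  obtain ⟨s, hs, hs1, hsδ₁, hsδ₂⟩ : ∃ s > 0, s ≤ 1 ∧ 2 * s ≤ δ₁ ∧ 2 * s ≤ δ₂ := by
    refine ⟨min 1 (min (δ₁ / 2) (δ₂ / 2)), by positivity, min_le_left _ _, ?_, ?_⟩
    · have := (min_le_right 1 (min (δ₁ / 2) (δ₂ / 2))).trans (min_le_left _ _)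
      linarith
    · have := (min_le_right 1 (min (δ₁ / 2) (δ₂ / 2))).trans (min_le_right _ _)
      linarith
  have hW : ∀ j : ℕ, ∃ p ∈ D, ‖p.1 - v (j * s)‖ ≤ ε * s / 8 ∧ ‖p.2 - v' (j * s)‖ ≤ ε * s / 8 := by
    intro j
    have hmem : (v (j * s), v' (j * s)) ∈ closure D :=
      hD (hU.movingAverage_mem_generatorGraph x hσ.le (by positivity))
    obtain ⟨p, hp, hdist⟩ := Metric.mem_closure_iff.1 hmem (ε * s / 8) (by positivity)
    rw [dist_comm, dist_eq_norm, Prod.norm_def] at hdist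
    exact ⟨p, hp, (le_max_left _ _).trans hdist.le, (le_max_right _ _).trans hdist.le⟩
  choose W hWD hW₁ hW₂ using hW
  have hεs : ε * s / 8 ≤ ε / 4 := by nlinarith
  refine ⟨s, hs, W, hWD, fun t ht htT => ?_, fun a b ha hab hbT hbs =>
    norm_interpolate_fst_sub_sub_le hs hvd ha hab hbs (fun t ht hta => ?_) hW₁
      fun j => (hW₂ j).trans hεs⟩
  · have hft := floor_mul_le hs ht
    have hft' := lt_floor_add_one_mul (t := t) hs
    have hnode : ∀ i : ℕ, ⌊t / s⌋₊ ≤ i → i ≤ ⌊t / s⌋₊ + 1 → ‖(W i).1 - v t‖ ≤ ε / 2 := by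
      intro i hi hi'
      have hi1 : (⌊t / s⌋₊ : ℝ) ≤ i := by exact_mod_cast hi
      have hi2 : (i : ℝ) ≤ ⌊t / s⌋₊ + 1 := by exact_mod_cast hi'
      have h1 := hosc₁ (i * s) t (by positivity) (by nlinarith) ht (by linarith)
        (by rw [abs_le]; constructor <;> nlinarith)
      calc ‖(W i).1 - v t‖ = ‖((W i).1 - v (i * s)) + (v (i * s) - v t)‖ := by
            rw [sub_add_sub_cancel]
        _ ≤ ε / 4 + ε / 4 := (norm_add_le _ _).trans (add_le_add ((hW₁ i).trans hεs) h1)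
        _ = ε / 2 := by ring
    have h1 := norm_interpolate_sub_le (W := fun j => (W j).1) hs ht (hnode _ le_rfl (by omega))
      (hnode _ (by omega) le_rfl)
    have h2 := hσu t ht htT
    have h3 : u t = U t x := by simp [hudef, max_eq_left ht]
    rw [← h3, ← sub_add_sub_cancel _ (v t)]
    exact (norm_add_le _ _).trans (by linarith)
  · rw [abs_le] at hta
    exact hosc₂ t a ht (by linarith) ha (by linarith)
      (by rw [abs_le]; constructor <;> linarith)

end Orbit

section Convergence

lemma norm_pow_apply_sub_le {Y : Type*} [NormedAddCommGroup Y] [NormedSpace ℂ Y] (F : Y →L[ℂ] Y)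
    (y : ℕ → Y) {n : ℕ} {C d : ℝ} (hC : 0 ≤ C) (hF : ∀ k ≤ n, ‖F ^ k‖ ≤ C)
    (hd : ∀ k < n, ‖F (y k) - y (k + 1)‖ ≤ d) : ‖(F ^ n) (y 0) - y n‖ ≤ n * (C * d) := by
  suffices h : ∀ k ≤ n, ‖(F ^ n) (y 0) - (F ^ (n - k)) (y k)‖ ≤ k * (C * d) by
    simpa using h n le_rfl
  intro k hk
  induction k with
  | zero => simp
  | succ k ih =>
    have h1 : (F ^ (n - k)) (y k) - (F ^ (n - (k + 1))) (y (k + 1))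
        = (F ^ (n - (k + 1))) (F (y k) - y (k + 1)) := by
      rw [show n - k = n - (k + 1) + 1 by omega, pow_succ, mul_apply_eq_comp, map_sub]
    have h2 : ‖(F ^ (n - (k + 1))) (F (y k) - y (k + 1))‖ ≤ C * d :=
      ((F ^ (n - (k + 1))).le_of_opNorm_le (hF _ (by omega)) _).trans (by gcongr; exact hd k hk)
    rw [← sub_add_sub_cancel _ ((F ^ (n - k)) (y k)), h1]
    refine (norm_add_le _ _).trans ((add_le_add (ih (by omega)) h2).trans_eq ?_)
    push_cast
    ring

variable {X : Type*} [NormedAddCommGroup X] [NormedSpace ℂ X] [CompleteSpace X]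
  {Xm : ℕ → Type*} [∀ m, NormedAddCommGroup (Xm m)] [∀ m, NormedSpace ℂ (Xm m)]
  {P : ∀ m, X →L[ℂ] Xm m} {J : ∀ m, Xm m →L[ℂ] X} {F : ∀ m, ℝ → Xm m →L[ℂ] Xm m}

/-- **Chernoff product formula with spatial discretization**: a stable family `F`, consistent on
a core `D` of the generator, converges to the semigroup. -/
lemma tendsto_of_stable_of_consistent
    (hJP : ∀ x : X, Tendsto (fun m => J m (P m x)) atTop (𝓝 x))
    {K : ℝ} (hJ : ∀ m, ‖J m‖ ≤ K) (hP : ∀ m, ‖P m‖ ≤ K)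
    {U : ℝ → X →L[ℂ] X} (hU : IsC0Semigroup U) {D : Set (X × X)}
    (hD : generatorGraph U ⊆ closure D)
    (hcons : ∀ p ∈ D,
      ApproximatesVec P (fun m h => ((h : ℂ))⁻¹ • (F m h (P m p.1) - P m p.1)) p.2)
    {M ω : ℝ} (hstab : ∀ h : ℝ, 0 < h → ∀ k m : ℕ, ‖(F m h) ^ k‖ ≤ M * Real.exp (k * h * ω))
    (x : X) {T ε : ℝ} (hT : 0 ≤ T) (hε : 0 < ε) :
    ∃ N : ℕ, ∀ m ≥ N, ∀ n ≥ N, ∀ t : ℝ, 0 < t → t ≤ T →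
      ‖J m (((F m (t / n)) ^ n) (P m x)) - U t x‖ ≤ ε := by
  have hK : 0 ≤ K := (norm_nonneg _).trans (hP 0)
  have hM : 0 ≤ M := by
    have h := (norm_nonneg _).trans (hstab 1 one_pos 0 0)
    simpa using h
  set C := M * Real.exp (T * |ω|) with hCdef
  have hC : 0 ≤ C := by positivity
  set Q := K * C * K + K * (T * (C * (1 + K))) + 2 with hQ
  have hQpos : 0 < Q := by positivity
  set η := ε / Q with hη
  have hηpos : 0 < η := by positivity
  obtain ⟨s, hs, W, hWD, hWU, hWd⟩ := exists_interpolate_near_orbit hU hD x hT hηpos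
  set w : ℝ → X := interpolate s fun j => (W j).1 with hw
  set g : ℝ → X := interpolate s fun j => (W j).2 with hg
  set L := ⌊T / s⌋₊ + 1 with hL
  have hfloor : ∀ t, t ≤ T → ⌊t / s⌋₊ + 1 ≤ L := fun t ht =>
    Nat.succ_le_succ (Nat.floor_mono (by gcongr))
  have hev : ∀ᶠ p : ℕ × ℝ in spaceTime, ∀ j ≤ L,
      ‖((p.2 : ℂ))⁻¹ • (F p.1 p.2 (P p.1 (W j).1) - P p.1 (W j).1) - P p.1 (W j).2‖ ≤ η := by
    refine (Set.finite_Iic L).eventually_all.2 fun j _ => ?_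
    exact (hcons _ (hWD j)).eventually (eventually_le_nhds hηpos)
  have hevJ : ∀ᶠ m in atTop, ∀ j ≤ L, ‖J m (P m (W j).1) - (W j).1‖ ≤ η := by
    refine (Set.finite_Iic L).eventually_all.2 fun j _ => ?_
    have h := ((hJP (W j).1).sub_const (W j).1).norm
    rw [sub_self, norm_zero] at h
    exact h.eventually (eventually_le_nhds hηpos)
  obtain ⟨pm, hpm, ph, hph, hprod⟩ := eventually_prod_iff.1 hev
  obtain ⟨N₁, hN₁⟩ := eventually_atTop.1 (hpm.and hevJ)
  obtain ⟨δ, hδ, hδph⟩ := mem_nhdsGT_iff_exists_Ioo_subset.1 hph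
  obtain ⟨N₂, hN₂⟩ := exists_nat_gt (T / min δ s)
  refine ⟨max N₁ (max N₂ 1), fun m hm n hn t ht htT => ?_⟩
  have hm₁ : N₁ ≤ m := (le_max_left _ _).trans hm
  have hn₂ : N₂ ≤ n := ((le_max_left _ _).trans (le_max_right _ _)).trans hn
  have hn1 : 1 ≤ n := ((le_max_right _ _).trans (le_max_right _ _)).trans hn
  have hn0 : (0 : ℝ) < n := by exact_mod_cast hn1
  have hmin : 0 < min δ s := lt_min hδ hs
  set h := t / n with hh
  have hhpos : 0 < h := by positivity
  have hnh : n * h = t := by rw [hh]; field_simp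
  have hhlt : h < min δ s := by
    rw [hh, div_lt_iff₀ hn0]
    have h1 : T / min δ s < n := hN₂.trans_le (by exact_mod_cast hn₂)
    rw [div_lt_iff₀ hmin] at h1
    linarith
  have hFk : ∀ k ≤ n, ‖(F m h) ^ k‖ ≤ C := by
    intro k hk
    refine (hstab h hhpos k m).trans ?_
    have hk' : (k : ℝ) * h ≤ T := by
      have : (k : ℝ) ≤ n := by exact_mod_cast hk
      nlinarith
    have : (k : ℝ) * h * ω ≤ T * |ω| :=
      calc (k : ℝ) * h * ω ≤ (k : ℝ) * h * |ω| := by gcongr; exact le_abs_self ω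
        _ ≤ T * |ω| := by gcongr
    rw [hCdef]
    gcongr
  have hdefect : ∀ k < n, ‖F m h (P m (w (k * h))) - P m (w ((k + 1 : ℕ) * h))‖
      ≤ h * ((1 + K) * η) := by
    intro k hk
    have hk' : ((k + 1 : ℕ) : ℝ) ≤ n := by exact_mod_cast hk
    have hkT : ((k + 1 : ℕ) : ℝ) * h ≤ T := by
      refine le_trans ?_ htT
      rw [← hnh]
      gcongr
    have hk0 : 0 ≤ (k : ℝ) * h := by positivity
    have hsucc : ((k + 1 : ℕ) : ℝ) * h = k * h + h := by push_cast; ring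
    have hkT' : (k : ℝ) * h ≤ T := by linarith
    have h1 := hWd (k * h) ((k + 1 : ℕ) * h) hk0 (by linarith) hkT
      (by linarith [hhlt.trans_le (min_le_right δ s)])
    rw [hsucc, add_sub_cancel_left] at h1
    have h2 : ‖((h : ℂ))⁻¹ • (F m h (P m (w (k * h))) - P m (w (k * h)))
        - P m (g (k * h))‖ ≤ η := by
      have hj := hprod (hN₁ m hm₁).1 (hδph ⟨hhpos, hhlt.trans_le (min_le_left _ _)⟩)
      have hlin : ((h : ℂ))⁻¹ • (F m h (P m (w (k * h))) - P m (w (k * h))) - P m (g (k * h))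
          = interpolate s (fun j => ((h : ℂ))⁻¹ • (F m h (P m (W j).1) - P m (W j).1)
            - P m (W j).2) (k * h) := by
        simp only [hw, hg, interpolate, ← Complex.coe_smul, map_add, map_smul]
        module
      rw [hlin]
      exact norm_interpolate_le hs hk0 (hj _ ((Nat.le_succ _).trans (hfloor _ hkT')))
        (hj _ (hfloor _ hkT'))
    have hsplit : F m h (P m (w (k * h))) - P m (w ((k + 1 : ℕ) * h))
        = (h : ℂ) • (((h : ℂ))⁻¹ • (F m h (P m (w (k * h))) - P m (w (k * h)))
          - P m (g (k * h)))
          - P m (w (k * h + h) - w (k * h) - h • g (k * h)) := by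
      have hh' : (h : ℂ) ≠ 0 := by exact_mod_cast hhpos.ne'
      rw [hsucc, smul_sub, smul_smul, mul_inv_cancel₀ hh', one_smul, map_sub, map_sub,
        ← Complex.coe_smul h (g _), map_smul]
      abel
    rw [hsplit]
    have h3 : ‖P m (w (k * h + h) - w (k * h) - h • g (k * h))‖ ≤ K * (η * h) :=
      ((P m).le_of_opNorm_le (hP m) _).trans (by gcongr)
    refine (norm_sub_le _ _).trans ((add_le_add (b := h * η) ?_ h3).trans_eq (by ring))
    rw [norm_smul, Complex.norm_real, Real.norm_of_nonneg hhpos.le]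
    gcongr
  have htel := norm_pow_apply_sub_le (F m h) (fun k => P m (w (k * h))) hC hFk hdefect
  simp only [Nat.cast_zero, zero_mul, hnh] at htel
  have hJw : ‖J m (P m (w t)) - w t‖ ≤ η := by
    have hlin : J m (P m (w t)) - w t
        = interpolate s (fun j => J m (P m (W j).1) - (W j).1) t := by
      simp only [hw, interpolate, ← Complex.coe_smul, map_add, map_smul]
      module
    rw [hlin]
    have hj := (hN₁ m hm₁).2
    exact norm_interpolate_le hs ht.le (hj _ ((Nat.le_succ _).trans (hfloor _ htT)))
      (hj _ (hfloor _ htT))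
  have hx : ‖x - w 0‖ ≤ η := by
    have h0 := hWU 0 le_rfl hT
    rw [hU.1, norm_sub_rev] at h0
    exact h0
  have hinit : ‖J m ((F m h ^ n) (P m (x - w 0)))‖ ≤ K * (C * (K * η)) := by
    refine ((J m).le_of_opNorm_le (hJ m) _).trans ?_
    gcongr
    refine ((F m h ^ n).le_of_opNorm_le (hFk n le_rfl) _).trans ?_
    gcongr
    exact ((P m).le_of_opNorm_le (hP m) _).trans (by gcongr)
  have hmid : ‖J m ((F m h ^ n) (P m (w 0)) - P m (w t))‖ ≤ K * (T * (C * ((1 + K) * η))) := by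
    refine ((J m).le_of_opNorm_le (hJ m) _).trans ?_
    gcongr
    refine htel.trans ?_
    calc n * (C * (h * ((1 + K) * η))) = (n * h) * (C * ((1 + K) * η)) := by ring
      _ ≤ T * (C * ((1 + K) * η)) := by rw [hnh]; gcongr
  have hsplit : J m ((F m h ^ n) (P m x)) - U t x
      = J m ((F m h ^ n) (P m (x - w 0))) + J m ((F m h ^ n) (P m (w 0)) - P m (w t))
        + (J m (P m (w t)) - w t) + (w t - U t x) := by
    simp only [map_sub]; abel
  rw [hsplit]
  calc _ ≤ K * (C * (K * η)) + K * (T * (C * ((1 + K) * η))) + η + η :=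
        (norm_add_le _ _).trans (add_le_add ((norm_add_le _ _).trans (add_le_add
          ((norm_add_le _ _).trans (add_le_add hinit hmid)) hJw)) (hWU t ht.le htT))
    _ = Q * η := by rw [hQ]; ring
    _ = ε := by rw [hη]; field_simp

end Convergence

/-- **Convergence of the Strang splitting with spatial and rational temporal
discretization.** Under the stability bound
`‖[r((h/2) A m) q(h B m) r((h/2) A m)]^k‖ ≤ M₁ e^{khω}`,
`J m [r((t/2n) A m) q((t/n) B m) r((t/2n) A m)]^n P m x → U(t) x` as `m, n → ∞`,
uniformly for `t` in compact intervals of `[0, ∞)`. -/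
theorem strang_splitting_convergence
    (X : Type*) [NormedAddCommGroup X] [NormedSpace ℂ X] [CompleteSpace X]
    (Xm : ℕ → Type*) [∀ m, NormedAddCommGroup (Xm m)] [∀ m, NormedSpace ℂ (Xm m)]
    [∀ m, CompleteSpace (Xm m)]
    -- the approximation scheme
    (P : ∀ m, X →L[ℂ] Xm m) (J : ∀ m, Xm m →L[ℂ] X)
    (hPJ : ∀ m (y : Xm m), P m (J m y) = y)
    (hJP : ∀ x : X, Tendsto (fun m => J m (P m x)) atTop (𝓝 x))
    (K : ℝ) (hK : 0 < K) (hJnorm : ∀ m, ‖J m‖ ≤ K) (hPnorm : ∀ m, ‖P m‖ ≤ K)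
    -- the operators `A, A m`: closed and densely defined
    (A : X →ₗ.[ℂ] X) (hAclosed : IsClosed (A.graph : Set (X × X)))
    (hAdense : Dense (A.domain : Set X))
    (Am : ∀ m, Xm m →ₗ.[ℂ] Xm m)
    (hAmclosed : ∀ m, IsClosed ((Am m).graph : Set (Xm m × Xm m)))
    (hAmdense : ∀ m, Dense ((Am m).domain : Set (Xm m)))
    -- stability of the family `A, A m`
    (RA : ℂ → X →L[ℂ] X) (RAm : ∀ m, ℂ → Xm m →L[ℂ] Xm m) (MA : ℝ) (hMA : 0 ≤ MA)
    (hRA : ∀ lam : ℂ, 0 < lam.re → IsResolvent A lam (RA lam) ∧ lam.re * ‖RA lam‖ ≤ MA)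
    (hRAm : ∀ m, ∀ lam : ℂ, 0 < lam.re →
      IsResolvent (Am m) lam (RAm m lam) ∧ lam.re * ‖RAm m lam‖ ≤ MA)
    -- consistency of the family `A, A m`
    (hPdomA : ∀ m, ∀ x ∈ A.domain, P m x ∈ (Am m).domain)
    (hconsA : ∀ x : A.domain,
      Tendsto (fun m => J m ((Am m) ⟨P m (x : X), hPdomA m x x.2⟩)) atTop (𝓝 (A x)))
    -- the operators `B, B m`: closed and densely defined
    (B : X →ₗ.[ℂ] X) (hBclosed : IsClosed (B.graph : Set (X × X)))
    (hBdense : Dense (B.domain : Set X))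
    (Bm : ∀ m, Xm m →ₗ.[ℂ] Xm m)
    (hBmclosed : ∀ m, IsClosed ((Bm m).graph : Set (Xm m × Xm m)))
    (hBmdense : ∀ m, Dense ((Bm m).domain : Set (Xm m)))
    -- stability of the family `B, B m`
    (RB : ℂ → X →L[ℂ] X) (RBm : ∀ m, ℂ → Xm m →L[ℂ] Xm m) (MB : ℝ) (hMB : 0 ≤ MB)
    (hRB : ∀ lam : ℂ, 0 < lam.re → IsResolvent B lam (RB lam) ∧ lam.re * ‖RB lam‖ ≤ MB)
    (hRBm : ∀ m, ∀ lam : ℂ, 0 < lam.re →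
      IsResolvent (Bm m) lam (RBm m lam) ∧ lam.re * ‖RBm m lam‖ ≤ MB)
    -- consistency of the family `B, B m`
    (hPdomB : ∀ m, ∀ x ∈ B.domain, P m x ∈ (Bm m).domain)
    (hconsB : ∀ x : B.domain,
      Tendsto (fun m => J m ((Bm m) ⟨P m (x : X), hPdomB m x x.2⟩)) atTop (𝓝 (B x)))
    -- the rational function `r`, via its partial fraction decomposition
    (lr : ℕ) (νr : Fin lr → ℕ) (hνr : ∀ i, 1 ≤ νr i) (lamr : Fin lr → ℂ)
    (Cr : Fin lr → ℕ → ℂ) (hlamr : ∀ i, 0 < (lamr i).re)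
    (hr0 : pfdFun lr νr lamr Cr 0 = 1)
    (hr1 : HasDerivAt (pfdFun lr νr lamr Cr) 1 0)
    (hrbdd : ∃ Cb : ℝ, ∀ z : ℂ, z.re ≤ 0 → ‖pfdFun lr νr lamr Cr z‖ ≤ Cb)
    -- the rational function `q`, via its partial fraction decomposition
    (lq : ℕ) (νq : Fin lq → ℕ) (hνq : ∀ i, 1 ≤ νq i) (lamq : Fin lq → ℂ)
    (Cq : Fin lq → ℕ → ℂ) (hlamq : ∀ i, 0 < (lamq i).re)
    (hq0 : pfdFun lq νq lamq Cq 0 = 1)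
    (hq1 : HasDerivAt (pfdFun lq νq lamq Cq) 1 0)
    (hqbdd : ∃ Cb : ℝ, ∀ z : ℂ, z.re ≤ 0 → ‖pfdFun lq νq lamq Cq z‖ ≤ Cb)
    -- `A` and `B` generate strongly continuous semigroups on `X`
    (TA : ℝ → X →L[ℂ] X) (hTA : IsGenerator A TA)
    (TB : ℝ → X →L[ℂ] X) (hTB : IsGenerator B TB)
    -- the closure of `A + B` (defined on `D(A) ∩ D(B)`) generates the semigroup `U`
    (U : ℝ → X →L[ℂ] X) (hU : IsC0Semigroup U)
    (hgen : closure {p : X × X | ∃ (hA : p.1 ∈ A.domain) (hB : p.1 ∈ B.domain),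
        A ⟨p.1, hA⟩ + B ⟨p.1, hB⟩ = p.2} = generatorGraph U)
    -- the stability bound
    (M₁ : ℝ) (hM₁ : 1 ≤ M₁) (ω : ℝ)
    (hstab : ∀ h : ℝ, 0 < h → ∀ k m : ℕ,
      ‖(ratOp lr νr lamr Cr (RAm m) (h / 2) * ratOp lq νq lamq Cq (RBm m) h
          * ratOp lr νr lamr Cr (RAm m) (h / 2)) ^ k‖
        ≤ M₁ * Real.exp (k * h * ω))
 :
    ∀ x : X, ∀ t₀ : ℝ, 0 ≤ t₀ → ∀ ε > (0 : ℝ), ∃ N : ℕ, ∀ m ≥ N, ∀ n ≥ N,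
      ∀ t : ℝ, 0 ≤ t → t ≤ t₀ →
        ‖J m (((ratOp lr νr lamr Cr (RAm m) (t / (2 * n))
            * ratOp lq νq lamq Cq (RBm m) (t / n)
            * ratOp lr νr lamr Cr (RAm m) (t / (2 * n))) ^ n) (P m x)) - U t x‖ ≤ ε := by
  have hconsA' : ∀ x : A.domain,
      ApproximatesVec P (fun m _ => Am m ⟨P m (x : X), hPdomA m x x.2⟩) (A x) :=
    fun x => approximatesVec_of_consistent hPJ hJP hPnorm (hconsA x)
  have hconsB' : ∀ x : B.domain,
      ApproximatesVec P (fun m _ => Bm m ⟨P m (x : X), hPdomB m x x.2⟩) (B x) :=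
    fun x => approximatesVec_of_consistent hPJ hJP hPnorm (hconsB x)
  have hNA := fun i => isApproxId_smul_resolvent hPnorm hMA hAdense hRAm hPdomA hconsA' (hlamr i)
  have hNB := fun i => isApproxId_smul_resolvent hPnorm hMB hBdense hRBm hPdomB hconsB' (hlamq i)
  intro x t₀ ht₀ ε hε
  obtain ⟨N₁, hN₁⟩ := tendsto_of_stable_of_consistent hJP hJnorm hPnorm hU hgen.superset
    (F := fun m h => ratOp lr νr lamr Cr (RAm m) (h / 2) * ratOp lq νq lamq Cq (RBm m) h
      * ratOp lr νr lamr Cr (RAm m) (h / 2)) (by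
      rintro ⟨y, z⟩ ⟨hyA, hyB, hyz⟩
      rw [← hyz]
      exact strang_consistent (isApproxId_ratOp hNA hr0) (isApproxId_ratOp hNB hq0)
        (ratOp_consistent hNA hr0 hr1 hlamr (fun m μ hμ => (hRAm m μ hμ).1) hPdomA hconsA'
          ⟨y, hyA⟩)
        (ratOp_consistent hNB hq0 hq1 hlamq (fun m μ hμ => (hRBm m μ hμ).1) hPdomB hconsB'
          ⟨y, hyB⟩)) hstab x ht₀ hε
  obtain ⟨N₂, hN₂⟩ := Metric.tendsto_atTop.1 (hJP x) ε hε
  refine ⟨max N₁ N₂, fun m hm n hn t ht htt => ?_⟩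
  obtain rfl | htpos := ht.eq_or_lt
  · have h := (hN₂ m ((le_max_right _ _).trans hm)).le
    rw [dist_eq_norm] at h
    simpa [ratOp, hU.1] using h
  · have h := hN₁ m ((le_max_left _ _).trans hm) n ((le_max_left _ _).trans hn) t htpos htt
    rwa [div_div, mul_comm (n : ℝ) 2] at h
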